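/- arXiv:2506.01528 — 4 statements merged into one kernel-verified Lean document; each statement's English description precedes it below -/
import Mathlib

section
/- Let K be a field equipped with the trivial valuation (|0| = 0 and |x| = 1 for all x ≠ 0), let n ≥ 2, and let ‖·‖ be a non-Archimedean norm on K^n that takes at least n distinct nonzero values. Then K^n is not paradoxical with respect to the group IA(K^n,‖·‖) of affine isometries of (K^n,‖·‖), for any number of pieces. -/
/-- `N` is a non-Archimedean norm on the `K`-vector space `X` with respect to the
valuation `v` on `K`. -/
def IsNANorm {K : Type*} [Field K] (v : K → ℝ) {X : Type*} [AddCommGroup X] [Module K X]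
    (N : X → ℝ) : Prop :=
  (∀ x, 0 ≤ N x) ∧ (∀ x, N x = 0 ↔ x = 0) ∧
    (∀ (c : K) (x : X), N (c • x) = v c * N x) ∧ (∀ x y, N (x + y) ≤ max (N x) (N y))

/-- `f ∈ IA(K^n, N)`: `f` is a surjective affine isometry of `(K^n, N)`. -/
def MemIA {K : Type*} [Field K] {n : ℕ} (N : (Fin n → K) → ℝ)
    (f : (Fin n → K) → Fin n → K) : Prop :=
  (∃ (A : Matrix (Fin n) (Fin n) K) (τ : Fin n → K), ∀ x, f x = A.mulVec x + τ) ∧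
    Function.Surjective f ∧ ∀ x y, N (f x - f y) = N (x - y)

/-- A nonempty set `E ⊆ X` is paradoxical using `r` pieces with respect to the
set `S` of transformations of `X`: there are `m, k ≥ 1` with `m + k = r`,
pairwise disjoint pieces `A₁, …, A_m, B₁, …, B_k ⊆ E` covering `E`, and
transformations `g i, h j ∈ S` such that the images `g i '' A i` partition `E`
and the images `h j '' B j` partition `E`. -/
def ParadoxicalUsing {X : Type*} (S : Set (X → X)) (E : Set X) (r : ℕ) : Prop :=
  ∃ (m k : ℕ), 1 ≤ m ∧ 1 ≤ k ∧ m + k = r ∧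
    ∃ (A : Fin m → Set X) (B : Fin k → Set X) (g : Fin m → X → X) (h : Fin k → X → X),
      (∀ i, g i ∈ S) ∧ (∀ j, h j ∈ S) ∧
      (∀ i, A i ⊆ E) ∧ (∀ j, B j ⊆ E) ∧
      (∀ i i', i ≠ i' → Disjoint (A i) (A i')) ∧
      (∀ j j', j ≠ j' → Disjoint (B j) (B j')) ∧
      (∀ i j, Disjoint (A i) (B j)) ∧
      ((⋃ i, A i) ∪ ⋃ j, B j) = E ∧
      (∀ i i', i ≠ i' → Disjoint (g i '' A i) (g i' '' A i')) ∧
      (⋃ i, g i '' A i) = E ∧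
      (∀ j j', j ≠ j' → Disjoint (h j '' B j) (h j' '' B j')) ∧
      (⋃ j, h j '' B j) = E

open scoped commutatorElement

/-- averaging operators over `H` -/
inductive AvgOp {Γ V : Type*} [Group Γ] [AddCommGroup V] [Module ℝ V]
    (ρ : Γ →* (V →ₗ[ℝ] V)) (H : Subgroup Γ) : (V →ₗ[ℝ] V) → Prop
  | of (h : Γ) : h ∈ H → AvgOp ρ H (ρ h)
  | cvx (S T : V →ₗ[ℝ] V) (a b : ℝ) : AvgOp ρ H S → AvgOp ρ H T → 0 ≤ a → 0 ≤ b → a + b = 1 →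
      AvgOp ρ H (a • S + b • T)
  | mul (S T : V →ₗ[ℝ] V) : AvgOp ρ H S → AvgOp ρ H T → AvgOp ρ H (S * T)

/-- invariant sublinear functional normalized at `u` -/
structure SubLin {Γ V : Type*} [Group Γ] [AddCommGroup V] [Module ℝ V]
    (ρ : Γ →* (V →ₗ[ℝ] V)) (u : V) (p : V → ℝ) : Prop where
  add : ∀ x y, p (x + y) ≤ p x + p y
  smul : ∀ (c : ℝ) x, 0 ≤ c → p (c • x) ≤ c * p x
  inv : ∀ g x, p (ρ g x) ≤ p x
  one : 1 ≤ p u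

section
variable {Γ V : Type*} [Group Γ] [AddCommGroup V] [Module ℝ V]
    {ρ : Γ →* (V →ₗ[ℝ] V)} {u : V} {p : V → ℝ} {H H' : Subgroup Γ}

theorem AvgOp.le (hp : SubLin ρ u p) {T : V →ₗ[ℝ] V} (hT : AvgOp ρ H T) :
    ∀ x, p (T x) ≤ p x := by
  induction hT with
  | of h hh => exact hp.inv h
  | cvx S T a b hS hT ha hb hab ihS ihT =>
    intro x
    simp only [LinearMap.add_apply, LinearMap.smul_apply]
    have h1 := hp.add (a • S x) (b • T x)
    have h2 := hp.smul a (S x) ha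
    have h3 := hp.smul b (T x) hb
    have h4 := mul_le_mul_of_nonneg_left (ihS x) ha
    have h5 := mul_le_mul_of_nonneg_left (ihT x) hb
    have h6 : a * p x + b * p x = p x := by rw [← add_mul, hab, one_mul]
    linarith
  | mul S T hS hT ihS ihT => intro x; exact (ihS _).trans (ihT x)

theorem AvgOp.fix (hu : ∀ g, ρ g u = u) {T : V →ₗ[ℝ] V} (hT : AvgOp ρ H T) : T u = u := by
  induction hT with
  | of h hh => exact hu h
  | cvx S T a b hS hT ha hb hab ihS ihT =>
    simp only [LinearMap.add_apply, LinearMap.smul_apply, ihS, ihT]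
    rw [← add_smul, hab, one_smul]
  | mul S T hS hT ihS ihT => simp [Module.End.mul_apply, ihS, ihT]

theorem AvgOp.conj [H.Normal] (g : Γ) {T : V →ₗ[ℝ] V} (hT : AvgOp ρ H T) :
    AvgOp ρ H (ρ g * T * ρ g⁻¹) := by
  induction hT with
  | of h hh =>
    rw [← map_mul, ← map_mul]
    exact AvgOp.of _ (Subgroup.Normal.conj_mem inferInstance h hh g)
  | cvx S T a b hS hT ha hb hab ihS ihT =>
    have := AvgOp.cvx _ _ a b ihS ihT ha hb hab
    convert this using 1
    simp [mul_add, add_mul]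
  | mul S T hS hT ihS ihT =>
    have := AvgOp.mul _ _ ihS ihT
    convert this using 1
    have h1 : ρ g⁻¹ * ρ g = 1 := by rw [← map_mul]; simp
    calc _ = ρ g * S * 1 * T * ρ g⁻¹ := by simp [mul_assoc]
      _ = _ := by rw [← h1]; simp only [mul_assoc]

theorem SubLin.zero (hp : SubLin ρ u p) : 0 ≤ p 0 := by
  have := hp.add 0 0
  simp at this; exact this

theorem SubLin.zero' (hp : SubLin ρ u p) : p 0 ≤ 0 := by
  have := hp.smul 0 0 le_rfl
  simpa using this

theorem AvgOp.comm (hp : SubLin ρ u p) (hH : ⁅H, H⁆ ≤ H') (hinv : ∀ g ∈ H', ∀ x, p (ρ g x - x) ≤ 0)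
    {S T : V →ₗ[ℝ] V} (hS : AvgOp ρ H S) (hT : AvgOp ρ H T) :
    ∀ x, p (S (T x) - T (S x)) ≤ 0 := by
  induction hS with
  | of h hh =>
    induction hT with
    | of k hk =>
      intro x
      have := hinv ⁅h, k⁆ (hH (Subgroup.commutator_mem_commutator hh hk)) (ρ k (ρ h x))
      convert this using 3
      simp only [← Module.End.mul_apply, ← map_mul]
      congr 2
      simp [commutatorElement_def, mul_assoc]
    | cvx S T a b hS hT ha hb hab ihS ihT =>
      intro x
      simp only [LinearMap.add_apply, LinearMap.smul_apply, map_add, map_smul]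
      have e : a • ρ h (S x) + b • ρ h (T x) - (a • S (ρ h x) + b • T (ρ h x))
        = a • (ρ h (S x) - S (ρ h x)) + b • (ρ h (T x) - T (ρ h x)) := by module
      rw [e]
      refine (hp.add _ _).trans ?_
      have h2 := hp.smul a (ρ h (S x) - S (ρ h x)) ha
      have h3 := hp.smul b (ρ h (T x) - T (ρ h x)) hb
      have h4 := mul_nonpos_of_nonneg_of_nonpos ha (ihS x)
      have h5 := mul_nonpos_of_nonneg_of_nonpos hb (ihT x)
      linarith
    | mul S T hS hT ihS ihT =>
      intro x
      simp only [Module.End.mul_apply]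
      have e : ρ h (S (T x)) - S (T (ρ h x)) =
        (ρ h (S (T x)) - S (ρ h (T x))) + S (ρ h (T x) - T (ρ h x)) := by
          rw [map_sub]; abel
      rw [e]
      have := hp.add (ρ h (S (T x)) - S (ρ h (T x))) (S (ρ h (T x) - T (ρ h x)))
      have h1 := ihS (T x)
      have h2 := hS.le hp (ρ h (T x) - T (ρ h x))
      have h3 := ihT x
      linarith
  | cvx S S' a b hS hS' ha hb hab ihS ihS' =>
      intro x
      simp only [LinearMap.add_apply, LinearMap.smul_apply, map_add, map_smul]
      have e : a • S (T x) + b • S' (T x) - (a • T (S x) + b • T (S' x))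
        = a • (S (T x) - T (S x)) + b • (S' (T x) - T (S' x)) := by module
      rw [e]
      refine (hp.add _ _).trans ?_
      have h2 := hp.smul a (S (T x) - T (S x)) ha
      have h3 := hp.smul b (S' (T x) - T (S' x)) hb
      have h4 := mul_nonpos_of_nonneg_of_nonpos ha (ihS x)
      have h5 := mul_nonpos_of_nonneg_of_nonpos hb (ihS' x)
      linarith
  | mul S S' hS hS' ihS ihS' =>
      intro x
      simp only [Module.End.mul_apply]
      have e : S (S' (T x)) - T (S (S' x)) =
        S (S' (T x) - T (S' x)) + (S (T (S' x)) - T (S (S' x))) := by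
          rw [map_sub]; abel
      rw [e]
      have := hp.add (S (S' (T x) - T (S' x))) (S (T (S' x)) - T (S (S' x)))
      have h1 := ihS (S' x)
      have h2 := hS.le hp (S' (T x) - T (S' x))
      have h3 := ihS' x
      linarith

theorem AvgOp.cesaro (h : Γ) (hh : h ∈ H) (n : ℕ) :
    ∃ T, AvgOp ρ H T ∧ ∀ x, T (ρ h x - x) = ((n : ℝ) + 1)⁻¹ • (ρ (h ^ (n + 1)) x - x) := by
  induction n with
  | zero =>
    refine ⟨ρ 1, AvgOp.of 1 H.one_mem, fun x => ?_⟩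
    simp
  | succ n ih =>
    obtain ⟨T, hT, hx⟩ := ih
    have hn : (0 : ℝ) < (n : ℝ) + 1 := by positivity
    refine ⟨(((n : ℝ) + 1) / (n + 2)) • T + ((1 : ℝ) / (n + 2)) • ρ (h ^ (n + 1)),
      AvgOp.cvx _ _ _ _ hT (AvgOp.of _ (H.pow_mem hh _)) (by positivity) (by positivity)
        (by field_simp; ring), fun x => ?_⟩
    simp only [LinearMap.add_apply, LinearMap.smul_apply, hx]
    have e : ρ (h ^ (n + 1)) (ρ h x - x) = ρ (h ^ (n + 1 + 1)) x - ρ (h ^ (n + 1)) x := by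
      rw [map_sub, pow_succ h (n + 1), map_mul]; rfl
    rw [e, smul_smul]
    have e1 : ((n : ℝ) + 1) / (n + 2) * ((n : ℝ) + 1)⁻¹ = 1 / (n + 2) := by field_simp
    have e2 : (((n + 1 : ℕ) : ℝ) + 1)⁻¹ = 1 / (n + 2) := by push_cast; rw [one_div]; congr 1; ring
    rw [e1, e2]
    module

theorem SubLin.step [H.Normal] (hu : ∀ g, ρ g u = u) (hp : SubLin ρ u p) (hH : ⁅H, H⁆ ≤ H')
    (hinv : ∀ g ∈ H', ∀ x, p (ρ g x - x) ≤ 0) :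
    ∃ q, SubLin ρ u q ∧ ∀ g ∈ H, ∀ x, q (ρ g x - x) ≤ 0 := by
  let q : V → ℝ := fun x => ⨅ T : {T // AvgOp ρ H T}, p (T.1 x)
  have hne : Nonempty {T // AvgOp ρ H T} := ⟨⟨ρ 1, AvgOp.of 1 H.one_mem⟩⟩
  have hb : ∀ x, BddBelow (Set.range fun T : {T // AvgOp ρ H T} => p (T.1 x)) := by
    intro x
    refine ⟨- p (-x), ?_⟩
    rintro _ ⟨⟨T, hT⟩, rfl⟩
    have h1 := hp.add (T x) (T (-x))
    rw [← map_add] at h1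
    simp only [add_neg_cancel, map_zero] at h1
    have h2 := hp.zero
    have h3 := hT.le hp (-x)
    show - p (-x) ≤ p (T x)
    linarith
  have hle : ∀ x T, AvgOp ρ H T → q x ≤ p (T x) := fun x T hT => ciInf_le (hb x) ⟨T, hT⟩
  have hex : ∀ x, ∀ ε > 0, ∃ T, AvgOp ρ H T ∧ p (T x) < q x + ε := by
    intro x ε hε
    obtain ⟨⟨T, hT⟩, h⟩ := exists_lt_of_ciInf_lt (show q x < q x + ε by linarith)
    exact ⟨T, hT, h⟩
  refine ⟨q, ⟨?_, ?_, ?_, ?_⟩, ?_⟩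
  · intro x y
    refine le_of_forall_pos_le_add fun ε hε => ?_
    obtain ⟨S, hS, h1⟩ := hex x (ε / 2) (by linarith)
    obtain ⟨T, hT, h2⟩ := hex y (ε / 2) (by linarith)
    have h3 := hle (x + y) _ (AvgOp.mul S T hS hT)
    rw [map_add] at h3
    simp only [Module.End.mul_apply] at h3
    have h4 := hp.add (S (T x)) (S (T y))
    have h5 := hS.le hp (T y)
    have h6 := hp.add (T (S x)) (S (T x) - T (S x))
    have h7 := hT.le hp (S x)
    have h8 := hS.comm hp hH hinv hT x
    rw [add_sub_cancel] at h6
    linarith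
  · intro c x hc
    show q (c • x) ≤ c * ⨅ T : {T // AvgOp ρ H T}, p (T.1 x)
    rw [Real.mul_iInf_of_nonneg hc]
    refine le_ciInf fun T => (hle _ _ T.2).trans ?_
    rw [map_smul]
    exact hp.smul _ _ hc
  · intro g x
    refine le_ciInf fun T => (hle _ _ (T.2.conj g)).trans ?_
    have : (ρ g * T.1 * ρ g⁻¹) (ρ g x) = ρ g (T.1 x) := by
      simp only [Module.End.mul_apply]
      rw [← Module.End.mul_apply (ρ g⁻¹), ← map_mul]; simp
    rw [this]
    exact hp.inv _ _
  · refine le_ciInf fun T => ?_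
    rw [T.2.fix hu]; exact hp.one
  · intro g hg x
    have hM : ∀ n : ℕ, q (ρ g x - x) ≤ ((n : ℝ) + 1)⁻¹ * (p x + p (-x)) := by
      intro n
      obtain ⟨T, hT, h⟩ := AvgOp.cesaro (ρ := ρ) g hg n
      refine (hle _ T hT).trans ?_
      rw [h]
      refine (hp.smul _ _ (by positivity)).trans ?_
      refine mul_le_mul_of_nonneg_left ?_ (by positivity)
      rw [sub_eq_add_neg]
      have := hp.add (ρ (g ^ (n + 1)) x) (-x)
      have := hp.inv (g ^ (n + 1)) x
      linarith
    have ht : Filter.Tendsto (fun n : ℕ => ((n : ℝ) + 1)⁻¹ * (p x + p (-x))) Filter.atTop (nhds 0) := by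
      have := (tendsto_one_div_add_atTop_nhds_zero_nat (𝕜 := ℝ)).mul_const (p x + p (-x))
      simpa [one_div] using this
    exact ge_of_tendsto' ht hM

theorem SubLin.solvable [Group.IsSolvable Γ] (hu : ∀ g, ρ g u = u) (hp : SubLin ρ u p) :
    ∃ q, SubLin ρ u q ∧ ∀ g x, q (ρ g x - x) ≤ 0 := by
  obtain ⟨n, hn⟩ := Group.IsSolvable.solvable (G := Γ)
  have key : ∀ k ≤ n, ∃ q, SubLin ρ u q ∧ ∀ g ∈ derivedSeries Γ (n - k), ∀ x, q (ρ g x - x) ≤ 0 := by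
    intro k
    induction k with
    | zero =>
      intro _
      refine ⟨p, hp, fun g hg x => ?_⟩
      rw [Nat.sub_zero, hn, Subgroup.mem_bot] at hg
      subst hg
      simpa using hp.zero'
    | succ k ih =>
      intro hk
      obtain ⟨q, hq, hi⟩ := ih (by omega)
      refine hq.step hu (H' := derivedSeries Γ (n - k)) ?_ hi
      have : n - k = (n - (k + 1)) + 1 := by omega
      rw [this, derivedSeries_succ]
  obtain ⟨q, hq, hi⟩ := key n le_rfl
  refine ⟨q, hq, fun g x => hi g ?_ x⟩
  simp
end

/-- bounded functions -/
def BddFun (X : Type*) : Submodule ℝ (X → ℝ) where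
  carrier := {f | ∃ C, ∀ x, |f x| ≤ C}
  zero_mem' := ⟨0, by simp⟩
  add_mem' := by
    rintro f g ⟨C, hC⟩ ⟨D, hD⟩
    exact ⟨C + D, fun x => (abs_add_le _ _).trans (add_le_add (hC x) (hD x))⟩
  smul_mem' := by
    rintro c f ⟨C, hC⟩
    refine ⟨|c| * C, fun x => ?_⟩
    simp only [Pi.smul_apply, smul_eq_mul, abs_mul]
    exact mul_le_mul_of_nonneg_left (hC x) (abs_nonneg c)

/-- translation representation -/
def transRep {X : Type*} (G : Subgroup (Equiv.Perm X)) : G →* (BddFun X →ₗ[ℝ] BddFun X) where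
  toFun g :=
    { toFun := fun f => ⟨fun x => f.1 (g.1⁻¹ x), by
        obtain ⟨C, hC⟩ := f.2
        exact ⟨C, fun x => hC _⟩⟩
      map_add' := fun _ _ => rfl
      map_smul' := fun _ _ => rfl }
  map_one' := by ext; simp
  map_mul' := by intro a b; ext; simp

theorem transRep_apply {X : Type*} (G : Subgroup (Equiv.Perm X)) (g : G) (f : BddFun X) (x : X) :
    (transRep G g f).1 x = f.1 (g.1⁻¹ x) := rfl

theorem BddFun.bdd {X : Type*} (f : BddFun X) : BddAbove (Set.range f.1) := by
  obtain ⟨C, hC⟩ := f.2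
  refine ⟨C, ?_⟩
  rintro _ ⟨x, rfl⟩
  exact (le_abs_self _).trans (hC x)

/-- the constant one -/
def oneFun (X : Type*) : BddFun X := ⟨fun _ => 1, 1, by simp⟩

/-- indicator -/
noncomputable def indFun {X : Type*} (A : Set X) : BddFun X := ⟨A.indicator 1, 1, by
  classical
  intro x
  by_cases h : x ∈ A <;> simp [h]⟩

theorem supSubLin {X : Type*} [Nonempty X] (G : Subgroup (Equiv.Perm X)) :
    SubLin (transRep G) (oneFun X) (fun f => ⨆ x, f.1 x) where
  add f g := ciSup_le fun x => add_le_add (le_ciSup (BddFun.bdd f) x) (le_ciSup (BddFun.bdd g) x)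
  smul c f hc := ciSup_le fun x => mul_le_mul_of_nonneg_left (le_ciSup (BddFun.bdd f) x) hc
  inv g f := ciSup_le fun x => le_ciSup (BddFun.bdd f) _
  one := by simp [oneFun]

theorem sum_ind {X : Type*} {m : ℕ} (A : Fin m → Set X)
    (hd : ∀ i i', i ≠ i' → Disjoint (A i) (A i')) (x : X) :
    (∑ i, indFun (A i)).1 x = (⋃ i, A i).indicator 1 x := by
  classical
  have : (∑ i, indFun (A i)).1 x = ∑ i, (A i).indicator 1 x := by
    rw [AddSubmonoidClass.coe_finsetSum, Finset.sum_apply]; rfl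
  rw [this]
  by_cases h : x ∈ ⋃ i, A i
  · obtain ⟨i, hi⟩ := Set.mem_iUnion.1 h
    rw [Set.indicator_of_mem h, Finset.sum_eq_single i]
    · simp [hi]
    · intro j _ hj
      exact Set.indicator_of_notMem (fun h' => Set.disjoint_left.1 (hd j i hj) h' hi) _
    · simp
  · rw [Set.indicator_of_notMem h]
    refine Finset.sum_eq_zero fun i _ => Set.indicator_of_notMem (fun h' => h (Set.mem_iUnion.2 ⟨i, h'⟩)) _

theorem not_paradox {X : Type*} [Nonempty X] (G : Subgroup (Equiv.Perm X)) [Group.IsSolvable G]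
    (S : Set (X → X)) (hS : ∀ f ∈ S, ∃ g ∈ G, ⇑g = f) (r : ℕ) :
    ¬ ParadoxicalUsing S Set.univ r := by
  rintro ⟨m, k, -, -, -, A, B, g, h, hg, hh, -, -, dA, dB, dAB, hU, dgA, hgA, dhB, hhB⟩
  obtain ⟨q, hq, hi⟩ := (supSubLin G).solvable (fun g => rfl)
  have hind : ∀ (s : G) (A : Set X), indFun (s.1 '' A) = transRep G s (indFun A) := by
    intro s A
    apply Subtype.ext
    funext x
    rw [transRep_apply]
    simp only [indFun, Set.indicator]
    congr 1
    simp only [eq_iff_iff, Set.mem_image]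
    constructor
    · rintro ⟨y, hy, rfl⟩; simpa using hy
    · intro hx; exact ⟨_, hx, by simp⟩
  have hstep : ∀ f ∈ S, ∀ A, q (indFun (f '' A) - indFun A) ≤ 0 := by
    intro f hf A
    obtain ⟨s, hs, rfl⟩ := hS f hf
    rw [hind ⟨s, hs⟩ A]
    exact hi _ _
  have hsum : ∀ (n : ℕ) (F : Fin n → BddFun X), (∀ i, q (F i) ≤ 0) → q (∑ i, F i) ≤ 0 := by
    intro n F hF
    refine Finset.sum_induction F (fun f => q f ≤ 0) ?_ hq.zero' (fun i _ => hF i)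
    intro a b ha hb
    have := hq.add a b
    linarith
  have h1 : ∑ i, indFun (g i '' A i) = oneFun X := by
    apply Subtype.ext; funext x; rw [sum_ind _ dgA, hgA]; simp [oneFun]
  have h2 : ∑ i, indFun (h i '' B i) = oneFun X := by
    apply Subtype.ext; funext x; rw [sum_ind _ dhB, hhB]; simp [oneFun]
  have h3 : ∑ i, indFun (A i) + ∑ i, indFun (B i) = oneFun X := by
    apply Subtype.ext; funext x
    show (∑ i, indFun (A i)).1 x + (∑ i, indFun (B i)).1 x = 1
    rw [sum_ind _ dA, sum_ind _ dB]
    have hx : x ∈ (⋃ i, A i) ∪ ⋃ j, B j := by rw [hU]; trivial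
    have hdis : Disjoint (⋃ i, A i) (⋃ j, B j) := by
      rw [Set.disjoint_iUnion_left]; intro i
      rw [Set.disjoint_iUnion_right]; exact dAB i
    rcases hx with hx | hx
    · rw [Set.indicator_of_mem hx, Set.indicator_of_notMem (Set.disjoint_left.1 hdis hx)]; simp
    · rw [Set.indicator_of_mem hx, Set.indicator_of_notMem (Set.disjoint_right.1 hdis hx)]; simp
  have e : oneFun X = ∑ i, (indFun (g i '' A i) - indFun (A i)) +
      ∑ i, (indFun (h i '' B i) - indFun (B i)) := by
    rw [Finset.sum_sub_distrib, Finset.sum_sub_distrib, h1, h2]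
    calc oneFun X = oneFun X + oneFun X - oneFun X := by abel
      _ = oneFun X + oneFun X - (∑ i, indFun (A i) + ∑ i, indFun (B i)) := by rw [h3]
      _ = _ := by abel
  have h4 := hq.one
  rw [e] at h4
  have h5 := hq.add (∑ i, (indFun (g i '' A i) - indFun (A i))) (∑ i, (indFun (h i '' B i) - indFun (B i)))
  have h6 := hsum _ _ (fun i => hstep (g i) (hg i) (A i))
  have h7 := hsum _ _ (fun i => hstep (h i) (hh i) (B i))
  linarith

section
variable {K : Type*} [Field K] {n : ℕ}

/-- affine isometry permutations -/
def isoGrp (N : (Fin n → K) → ℝ) : Subgroup (Equiv.Perm (Fin n → K)) where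
  carrier := {f | (∀ x y, N (f x - f y) = N (x - y)) ∧
    ∀ (x y z : Fin n → K) (c : K), f (x + c • (y - z)) = f x + c • (f y - f z)}
  one_mem' := by simp
  mul_mem' := by
    rintro f g ⟨hf, hf'⟩ ⟨hg, hg'⟩
    refine ⟨fun x y => ?_, fun x y z c => ?_⟩
    · rw [Equiv.Perm.mul_apply, Equiv.Perm.mul_apply, hf, hg]
    · simp only [Equiv.Perm.mul_apply, hf', hg']
  inv_mem' := by
    rintro f ⟨hf, hf'⟩
    refine ⟨fun x y => ?_, fun x y z c => ?_⟩
    · rw [← hf]; simp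
    · rw [Equiv.Perm.inv_eq_iff_eq, hf']; simp

/-- chain of subgroups -/
def chainGrp (N : (Fin n → K) → ℝ) (F : ℕ → Submodule K (Fin n → K))
    (hF : ∀ k x y, N x = N y → x ∈ F k → y ∈ F k) (i j : ℕ) : Subgroup (isoGrp N) where
  carrier := {f | (∀ x, f.1 x - x ∈ F i) ∧
    ∀ x y, x - y ∈ F i → f.1 x - f.1 y - (x - y) ∈ F j}
  one_mem' := by simp
  mul_mem' := by
    rintro f g ⟨hf, hf'⟩ ⟨hg, hg'⟩
    refine ⟨fun x => ?_, fun x y h => ?_⟩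
    · have := (F i).add_mem (hf (g.1 x)) (hg x)
      simpa using this
    · have := (F j).add_mem (hf' (g.1 x) (g.1 y) (hF i _ _ (g.2.1 x y).symm h)) (hg' x y h)
      simpa using this
  inv_mem' := by
    rintro f ⟨hf, hf'⟩
    refine ⟨fun x => ?_, fun x y h => ?_⟩
    · have := (F i).neg_mem (hf (f.1⁻¹ x))
      simpa using this
    · have h1 := hf' (f.1⁻¹ x) (f.1⁻¹ y) (hF i _ _ (((isoGrp N).inv_mem f.2).1 x y).symm h)
      have := (F j).neg_mem h1
      simpa using this

theorem iso_solvable (N : (Fin n → K) → ℝ) (F : ℕ → Submodule K (Fin n → K))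
    (hF : ∀ k x y, N x = N y → x ∈ F k → y ∈ F k) (h0 : F 0 = ⊥) (hn : F n = ⊤)
    (hmono : ∀ i < n, F i ≤ F (i + 1))
    (h1 : ∀ i < n, ∃ e ∈ F (i + 1), ∀ v ∈ F (i + 1), ∃ c : K, v - c • e ∈ F i) :
    Group.IsSolvable (isoGrp N) := by
  have hiso : ∀ (f : isoGrp N) k x y, x - y ∈ F k → f.1 x - f.1 y ∈ F k :=
    fun f k x y h => hF k _ _ (f.2.1 x y).symm h
  have hcomm : ∀ (f g : isoGrp N) x, (⁅f, g⁆ : isoGrp N).1 (g.1 (f.1 x)) = f.1 (g.1 x) := by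
    intro f g x
    simp [commutatorElement_def]
  have hsurj : ∀ (f g : isoGrp N) x, ∃ y, x = g.1 (f.1 y) := by
    intro f g x
    exact ⟨f.1⁻¹ (g.1⁻¹ x), by simp⟩
  have hscal : ∀ i < n, ∀ f : isoGrp N, ∃ a : K, ∀ x y, x - y ∈ F (i + 1) →
      f.1 x - f.1 y - a • (x - y) ∈ F i := by
    intro i hi f
    obtain ⟨e, he, h⟩ := h1 i hi
    obtain ⟨a, ha⟩ := h _ (hiso f (i + 1) e 0 (by simpa using he))
    refine ⟨a, fun x y hxy => ?_⟩
    obtain ⟨c, hc⟩ := h _ hxy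
    have h2 : f.1 x - f.1 (y + c • (e - 0)) ∈ F i := by
      apply hiso
      convert hc using 1
      simp only [sub_zero]; abel
    rw [f.2.2] at h2
    have h3 := (F i).sub_mem ((F i).add_mem h2 ((F i).smul_mem c ha)) ((F i).smul_mem a hc)
    convert h3 using 1
    module
  have sA : ∀ i < n, ⁅chainGrp N F hF (i + 1) (i + 1), chainGrp N F hF (i + 1) (i + 1)⁆ ≤
      chainGrp N F hF (i + 1) i := by
    intro i hi
    rw [Subgroup.commutator_le]
    intro f hf g hg
    refine ⟨?_, ?_⟩
    · have : ⁅f, g⁆ ∈ chainGrp N F hF (i + 1) (i + 1) := by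
        rw [commutatorElement_def]
        exact mul_mem (mul_mem (mul_mem hf hg) (inv_mem hf)) (inv_mem hg)
      exact this.1
    · intro x y hxy
      obtain ⟨x, rfl⟩ := hsurj f g x
      obtain ⟨y, rfl⟩ := hsurj f g y
      rw [hcomm, hcomm]
      have hxy' : x - y ∈ F (i + 1) := by
        refine hF _ _ _ ?_ hxy
        rw [g.2.1, f.2.1]
      obtain ⟨a, ha⟩ := hscal i hi f
      obtain ⟨b, hb⟩ := hscal i hi g
      have e1 := ha _ _ (hiso g _ _ _ hxy')
      have e2 := hb _ _ (hiso f _ _ _ hxy')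
      have e3 := (F i).smul_mem b (ha _ _ hxy')
      have e4 := (F i).smul_mem a (hb _ _ hxy')
      convert (F i).sub_mem ((F i).add_mem e1 e4) ((F i).add_mem e2 e3) using 1
      module
  have sB : ∀ i < n, ⁅chainGrp N F hF (i + 1) i, chainGrp N F hF (i + 1) i⁆ ≤
      chainGrp N F hF i i := by
    intro i hi
    rw [Subgroup.commutator_le]
    intro f hf g hg
    refine ⟨?_, ?_⟩
    · intro x
      obtain ⟨x, rfl⟩ := hsurj f g x
      rw [hcomm]
      have e1 := hf.2 _ _ (hg.1 x)
      have e2 := hg.2 _ _ (hf.1 x)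
      convert (F i).sub_mem e1 e2 using 1
      abel
    · intro x y h
      exact (F i).sub_mem (hiso _ _ _ _ h) h
  have key : ∀ k ≤ n, derivedSeries (isoGrp N) (2 * k) ≤ chainGrp N F hF (n - k) (n - k) := by
    intro k
    induction k with
    | zero =>
      intro _ f _
      refine ⟨fun x => ?_, fun x y _ => ?_⟩ <;> simp [hn]
    | succ k ih =>
      intro hk
      have ih := ih (by omega)
      have e : n - k = (n - (k + 1)) + 1 := by omega
      rw [e] at ih
      have e2 : 2 * (k + 1) = 2 * k + 1 + 1 := by ring
      rw [e2, derivedSeries_succ, derivedSeries_succ]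
      have h2 := (Subgroup.commutator_mono ih ih).trans (sA (n - (k + 1)) (by omega))
      exact (Subgroup.commutator_mono h2 h2).trans (sB (n - (k + 1)) (by omega))
  refine ⟨2 * n, ?_⟩
  rw [eq_bot_iff]
  refine (key n le_rfl).trans ?_
  intro f hf
  rw [Subgroup.mem_bot]
  apply Subtype.ext
  ext1 x
  have := hf.1 x
  rw [Nat.sub_self, h0, Submodule.mem_bot, sub_eq_zero] at this
  simpa using this

theorem memIA_iso (N : (Fin n → K) → ℝ) (hN : ∀ x, N x = 0 ↔ x = 0) (f : (Fin n → K) → Fin n → K)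
    (hf : MemIA N f) : ∃ g ∈ isoGrp N, ⇑g = f := by
  obtain ⟨⟨A, τ, hA⟩, hs, hi⟩ := hf
  have hinj : Function.Injective f := by
    intro x y h
    have := hi x y
    rw [h, sub_self, (hN 0).2 rfl, eq_comm, hN, sub_eq_zero] at this
    exact this
  refine ⟨Equiv.ofBijective f ⟨hinj, hs⟩, ⟨hi, fun x y z c => ?_⟩, rfl⟩
  change f (x + c • (y - z)) = f x + c • (f y - f z)
  simp only [hA, Matrix.mulVec_add, Matrix.mulVec_smul, Matrix.mulVec_sub]
  module

theorem exists_chain (v : K → ℝ)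
    (hv0 : v 0 = 0) (hv1 : ∀ x : K, x ≠ 0 → v x = 1)
    (N : (Fin n → K) → ℝ) (hN : IsNANorm v N)
    (hval : ∃ w : Fin n → ℝ, Function.Injective w ∧
      ∀ j, w j ≠ 0 ∧ ∃ x : Fin n → K, N x = w j) :
    ∃ F : ℕ → Submodule K (Fin n → K), (∀ k x y, N x = N y → x ∈ F k → y ∈ F k) ∧ F 0 = ⊥ ∧
      ∀ i < n, F i < F (i + 1) := by
  classical
  obtain ⟨w, hw, hx⟩ := hval
  obtain ⟨N0, N1, N2, N3⟩ := hN
  have hcard : (Finset.univ.image w).card = n := by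
    rw [Finset.card_image_of_injective _ hw]; simp
  let s := (Finset.univ.image w).orderEmbOfFin hcard
  have hs : ∀ j, 0 < s j ∧ ∃ x, N x = s j := by
    intro j
    have := Finset.orderEmbOfFin_mem (Finset.univ.image w) hcard j
    simp only [Finset.mem_image, Finset.mem_univ, true_and] at this
    obtain ⟨i, hi⟩ := this
    obtain ⟨h1, x, h2⟩ := hx i
    have h3 : s j = w i := hi.symm
    refine ⟨?_, x, by rw [h2, h3]⟩
    rw [h3]
    exact lt_of_le_of_ne (h2 ▸ N0 x) h1.symm
  let t : ℕ → ℝ := fun k => if k = 0 then 0 else if h : k - 1 < n then s ⟨k - 1, h⟩ else 0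
  have ht0 : ∀ k, 0 ≤ t k := by
    intro k
    simp only [t]
    split_ifs
    · exact le_rfl
    · exact (hs _).1.le
    · exact le_rfl
  have hts : ∀ i (h : i < n), t (i + 1) = s ⟨i, h⟩ := by
    intro i h
    simp [t, h]
  have htlt : ∀ i < n, t i < t (i + 1) := by
    intro i h
    rw [hts i h]
    rcases i with _ | i
    · simpa [t] using (hs _).1
    · rw [hts i (by omega)]
      exact s.strictMono (by simp)
  let F : ℕ → Submodule K (Fin n → K) := fun k =>
    { carrier := {x | N x ≤ t k}
      zero_mem' := by
        show N 0 ≤ t k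
        rw [(N1 0).2 rfl]; exact ht0 k
      add_mem' := fun {a b} ha hb => (N3 a b).trans (max_le ha hb)
      smul_mem' := fun c x hx => by
        show N (c • x) ≤ t k
        rw [N2]
        by_cases hc : c = 0
        · rw [hc, hv0, zero_mul]; exact ht0 k
        · rw [hv1 c hc, one_mul]; exact hx }
  have hFm : ∀ k x, x ∈ F k ↔ N x ≤ t k := fun k x => Iff.rfl
  refine ⟨F, fun k x y h hx => ?_, ?_, fun i hi => ?_⟩
  · rw [hFm, ← h]; exact hx
  · rw [eq_bot_iff]
    intro x hx
    rw [hFm] at hx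
    have : N x = 0 := le_antisymm (by simpa [t] using hx) (N0 x)
    simpa using (N1 x).1 this
  · rw [SetLike.lt_iff_le_and_exists]
    refine ⟨fun x hx => ?_, ?_⟩
    · exact le_trans ((hFm _ _).1 hx) (htlt i hi).le
    · obtain ⟨x, hx⟩ := (hs ⟨i, hi⟩).2
      refine ⟨x, ?_, ?_⟩
      · rw [hFm, hx, hts i hi]
      · rw [hFm, hx, ← hts i hi, not_le]; exact htlt i hi

theorem chain_finrank (F : ℕ → Submodule K (Fin n → K)) (h0 : F 0 = ⊥) (hlt : ∀ i < n, F i < F (i + 1)) :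
    ∀ i ≤ n, Module.finrank K (F i) = i := by
  have hl : ∀ i < n, Module.finrank K (F i) < Module.finrank K (F (i + 1)) :=
    fun i hi => Submodule.finrank_lt_finrank_of_lt (hlt i hi)
  have h1 : ∀ i ≤ n, i ≤ Module.finrank K (F i) := by
    intro i
    induction i with
    | zero => intro _; exact Nat.zero_le _
    | succ i ih =>
      intro hi
      have := ih (by omega)
      have := hl i hi
      omega
  have h2 : ∀ k ≤ n, Module.finrank K (F (n - k)) + k ≤ n := by
    intro k
    induction k with
    | zero =>
      intro _
      have := Submodule.finrank_le (F n)
      simpa using this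
    | succ k ih =>
      intro hk
      have h3 := ih (by omega)
      have h4 := hl (n - (k + 1)) (by omega)
      have e : n - (k + 1) + 1 = n - k := by omega
      rw [e] at h4
      omega
  intro i hi
  have h3 := h1 i hi
  have h4 := h2 (n - i) (by omega)
  have e : n - (n - i) = i := by omega
  rw [e] at h4
  omega

theorem chain_span (F : ℕ → Submodule K (Fin n → K)) (h0 : F 0 = ⊥) (hlt : ∀ i < n, F i < F (i + 1)) :
    ∀ i < n, ∃ e ∈ F (i + 1), ∀ v ∈ F (i + 1), ∃ c : K, v - c • e ∈ F i := by
  intro i hi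
  have hr := chain_finrank F h0 hlt
  obtain ⟨hle, e, he, hne⟩ := SetLike.lt_iff_le_and_exists.1 (hlt i hi)
  refine ⟨e, he, fun v hv => ?_⟩
  have hlt2 : F i < F i ⊔ Submodule.span K {e} := by
    rw [SetLike.lt_iff_le_and_exists]
    exact ⟨le_sup_left, e, Submodule.mem_sup_right (Submodule.mem_span_singleton_self e), hne⟩
  have h3 := Submodule.finrank_lt_finrank_of_lt hlt2
  have hle2 : F i ⊔ Submodule.span K {e} ≤ F (i + 1) := by
    refine sup_le hle ?_
    rw [Submodule.span_singleton_le_iff_mem]; exact he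
  have heq := Submodule.eq_of_le_of_finrank_le hle2 (by
    rw [hr (i + 1) hi]; rw [hr i hi.le] at h3; exact h3)
  rw [← heq, Submodule.mem_sup] at hv
  obtain ⟨y, hy, z, hz, rfl⟩ := hv
  obtain ⟨c, rfl⟩ := Submodule.mem_span_singleton.1 hz
  exact ⟨c, by simpa using hy⟩
end


theorem statement15 {K : Type*} [Field K] (v : K → ℝ)
    -- v is the trivial valuation
    (hv0 : v 0 = 0) (hv1 : ∀ x : K, x ≠ 0 → v x = 1)
    (n : ℕ) (hn : 2 ≤ n) (N : (Fin n → K) → ℝ) (hN : IsNANorm v N)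
    -- N takes at least n distinct nonzero values
    (hval : ∃ w : Fin n → ℝ, Function.Injective w ∧
      ∀ j, w j ≠ 0 ∧ ∃ x : Fin n → K, N x = w j) :
    ∀ r : ℕ, ¬ ParadoxicalUsing {f | MemIA N f} (Set.univ : Set (Fin n → K)) r := by
  obtain ⟨F, hF, h0, hlt⟩ := exists_chain v hv0 hv1 N hN hval
  have hn' : F n = ⊤ := by
    apply Submodule.eq_top_of_finrank_eq
    rw [chain_finrank F h0 hlt n le_rfl]; simp
  have := iso_solvable N F hF h0 hn' (fun i hi => (hlt i hi).le) (chain_span F h0 hlt)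
  intro r
  exact not_paradox (isoGrp N) _ (fun f hf => memIA_iso N hN.2.1 f hf) r
end

section
/- Over a field K equipped with the trivial valuation (|0| = 0 and |x| = 1 for x ≠ 0), every non-Archimedean norm on K^n takes at most n distinct nonzero values; moreover, every closed ball B[0,r] = {x ∈ K^n : ‖x‖ ≤ r} with r > 0 is a K-linear subspace of K^n. -/
theorem statement16 {K : Type*} [Field K] (v : K → ℝ)
    -- v is the trivial valuation
    (hv0 : v 0 = 0) (hv1 : ∀ x : K, x ≠ 0 → v x = 1)
    (n : ℕ) (N : (Fin n → K) → ℝ) (hN : IsNANorm v N) :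
    -- N takes at most n distinct nonzero values …
    (∃ V : Finset ℝ, V.card ≤ n ∧ ∀ x : Fin n → K, x ≠ 0 → N x ∈ V) ∧
    -- … and every closed ball B[0, r], r > 0, is a K-linear subspace of K^n
    (∀ r : ℝ, 0 < r →
      ∃ W : Submodule K (Fin n → K), (W : Set (Fin n → K)) = {x | N x ≤ r}) := by
  obtain ⟨h0, hz, hs, ha⟩ := hN
  have hsm : ∀ (c : K) x, N (c • x) ≤ N x := by
    intro c x
    rw [hs]
    by_cases hc : c = 0
    · rw [hc, hv0, zero_mul]; exact h0 x
    · rw [hv1 c hc, one_mul]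
  have hB : ∀ r : ℝ, 0 ≤ r →
      ∃ W : Submodule K (Fin n → K), (W : Set (Fin n → K)) = {x | N x ≤ r} := by
    intro r hr
    refine ⟨{ carrier := {x | N x ≤ r}, add_mem' := ?_, zero_mem' := ?_, smul_mem' := ?_ }, rfl⟩
    · intro a b h1 h2
      exact (ha a b).trans (max_le h1 h2)
    · have : N 0 = 0 := (hz 0).2 rfl
      simpa [this] using hr
    · intro c x hx
      exact (hsm c x).trans hx
  refine ⟨?_, fun r hr => hB r hr.le⟩
  choose! W hW using hB
  have hmem : ∀ r, 0 ≤ r → ∀ x, x ∈ W r ↔ N x ≤ r := by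
    intro r hr x
    rw [← SetLike.mem_coe, hW r hr]; rfl
  let S : Set ℝ := {r | ∃ x, x ≠ 0 ∧ N x = r}
  have hlt : ∀ a ∈ S, ∀ b ∈ S, a < b →
      Module.finrank K (W a) < Module.finrank K (W b) := by
    rintro a ⟨x, hx, rfl⟩ b ⟨y, hy, rfl⟩ hab
    apply Submodule.finrank_lt_finrank_of_lt
    refine lt_of_le_of_ne ?_ ?_
    · intro z hz'
      rw [hmem _ (h0 _)] at hz' ⊢
      exact hz'.trans hab.le
    · intro he
      have : y ∈ W (N x) := by rw [he, hmem _ (h0 _)]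
      rw [hmem _ (h0 _)] at this
      linarith
  have hinj : Set.InjOn (fun r => Module.finrank K (W r)) S := by
    intro a ha' b hb' hab
    rcases lt_trichotomy a b with h | h | h
    · exact absurd hab (hlt a ha' b hb' h).ne
    · exact h
    · exact absurd hab (hlt b hb' a ha' h).ne'
  have hmaps : Set.MapsTo (fun r => Module.finrank K (W r)) S (Finset.Icc 1 n : Finset ℕ) := by
    rintro a ⟨x, hx, rfl⟩
    rw [Finset.mem_coe, Finset.mem_Icc]
    constructor
    · apply Submodule.one_le_finrank_iff.2
      intro he
      have : x ∈ W (N x) := by rw [hmem _ (h0 _)]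
      rw [he] at this
      exact hx (by simpa using this)
    · simpa using Submodule.finrank_le (W (N x))
  have hfin : S.Finite := Set.Finite.of_injOn hmaps hinj (Finset.finite_toSet _)
  refine ⟨hfin.toFinset, ?_, fun x hx => by simpa using ⟨x, hx, rfl⟩⟩
  have := Finset.card_le_card_of_injOn (s := hfin.toFinset) (t := Finset.Icc 1 n)
    (fun r => Module.finrank K (W r)) (by simpa using hmaps) (by simpa using hinj)
  simpa using this
end

section
/- Let K be a locally finite field (i.e., every finitely generated subfield of K is finite). Then for every positive integer n, the space K^n is not paradoxical with respect to the group GA(n,K) of all invertible affine transformations of K^n, for any number of pieces. -/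
theorem affine_pullback {K : Type*} [Field K] {n : ℕ} (F : Subfield K) (hF : (F : Set K).Finite)
    (A : Matrix (Fin n) (Fin n) K) (τ : Fin n → K) (hA : IsUnit A)
    (hAF : ∀ p q, A p q ∈ F) (hτ : ∀ p, τ p ∈ F) (x : Fin n → K)
    (hx : ∀ p, (A.mulVec x + τ) p ∈ F) : ∀ p, x p ∈ F := by
  have hP : ({y : Fin n → K | ∀ p, y p ∈ F}).Finite := by
    have := Set.Finite.pi' (fun _ : Fin n => hF)
    exact this
  have hinj : Function.Injective (fun y : Fin n → K => A.mulVec y + τ) := by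
    intro y z hyz
    exact Matrix.mulVec_injective_of_isUnit hA (add_right_cancel hyz)
  have hmaps : Set.MapsTo (fun y : Fin n → K => A.mulVec y + τ)
      {y : Fin n → K | ∀ p, y p ∈ F} {y : Fin n → K | ∀ p, y p ∈ F} := by
    intro y hy p
    refine F.add_mem (x := A.mulVec y p) ?_ (hτ p)
    simp only [Matrix.mulVec, dotProduct]
    exact F.sum_mem fun q _ => F.mul_mem (hAF p q) (hy q)
  have hsurj : Set.SurjOn (fun y : Fin n → K => A.mulVec y + τ)
      {y : Fin n → K | ∀ p, y p ∈ F} {y : Fin n → K | ∀ p, y p ∈ F} := by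
    have he := Set.eq_of_subset_of_ncard_le hmaps.image_subset
      (Set.ncard_image_of_injective _ hinj).ge hP
    exact he.ge
  obtain ⟨y, hy, hyx⟩ := hsurj hx
  have := hinj hyx
  rw [← this]
  exact hy

theorem pieces_map {X : Type*} {m : ℕ} (A : Fin m → Set X) (g : Fin m → X → X) (P : Set X)
    (hg : ∀ i x, g i x ∈ P → x ∈ P)
    (hd : ∀ i i', i ≠ i' → Disjoint (A i) (A i')) (hu : (⋃ i, g i '' A i) = Set.univ) :
    ∃ a : P → P, Function.Injective a ∧ ∀ x, ∃ i, (a x : X) ∈ A i := by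
  have h : ∀ x : P, ∃ i, ∃ y : P, (y : X) ∈ A i ∧ g i y = x := by
    intro x
    have hx : (x : X) ∈ ⋃ i, g i '' A i := hu ▸ Set.mem_univ _
    obtain ⟨i, y, hy, hyx⟩ := Set.mem_iUnion.1 hx
    exact ⟨i, ⟨y, hg i y (hyx ▸ x.2)⟩, hy, hyx⟩
  choose i a ha hga using h
  refine ⟨a, ?_, fun x => ⟨i x, ha x⟩⟩
  intro x y hxy
  have hi : i x = i y := by
    by_contra hne
    exact Set.disjoint_left.1 (hd _ _ hne) (ha x) (hxy ▸ ha y)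
  apply Subtype.ext
  rw [← hga x, ← hga y, hi, hxy]

theorem statement17 {K : Type*} [Field K]
    -- K is locally finite: every finitely generated subfield is finite
    (hlf : ∀ s : Finset K, (Subfield.closure (s : Set K) : Set K).Finite)
    (n : ℕ) (hn : 0 < n) :
    -- K^n is not GA(n, K)-paradoxical, for any number of pieces
    ∀ r : ℕ, ¬ ParadoxicalUsing
      {f : (Fin n → K) → Fin n → K |
        ∃ (A : Matrix (Fin n) (Fin n) K) (τ : Fin n → K), IsUnit A ∧ ∀ x, f x = A.mulVec x + τ}
      (Set.univ : Set (Fin n → K)) r := by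
  rintro r ⟨m, k, -, -, -, A, B, g, h, hg, hh, -, -, hA, hB, hAB, -, -, hgu, -, hhu⟩
  choose MA tA uA eA using hg
  choose MB tB uB eB using hh
  classical
  let s : Finset K :=
    (Finset.univ.image (fun t : Fin m × Fin n × Fin n => MA t.1 t.2.1 t.2.2)) ∪
    (Finset.univ.image (fun t : Fin m × Fin n => tA t.1 t.2)) ∪
    (Finset.univ.image (fun t : Fin k × Fin n × Fin n => MB t.1 t.2.1 t.2.2)) ∪
    (Finset.univ.image (fun t : Fin k × Fin n => tB t.1 t.2))
  let F := Subfield.closure (s : Set K)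
  have hF : (F : Set K).Finite := hlf s
  have hs : ∀ x ∈ s, x ∈ F := fun x hx => Subfield.subset_closure hx
  have h1 : ∀ i p q, MA i p q ∈ F := fun i p q => hs _ (by
    simp only [s, Finset.mem_union, Finset.mem_image]
    exact Or.inl (Or.inl (Or.inl ⟨(i, p, q), Finset.mem_univ _, rfl⟩)))
  have h2 : ∀ i p, tA i p ∈ F := fun i p => hs _ (by
    simp only [s, Finset.mem_union, Finset.mem_image]
    exact Or.inl (Or.inl (Or.inr ⟨(i, p), Finset.mem_univ _, rfl⟩)))
  have h3 : ∀ i p q, MB i p q ∈ F := fun i p q => hs _ (by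
    simp only [s, Finset.mem_union, Finset.mem_image]
    exact Or.inl (Or.inr ⟨(i, p, q), Finset.mem_univ _, rfl⟩))
  have h4 : ∀ i p, tB i p ∈ F := fun i p => hs _ (by
    simp only [s, Finset.mem_union, Finset.mem_image]
    exact Or.inr ⟨(i, p), Finset.mem_univ _, rfl⟩)
  let P : Set (Fin n → K) := {y | ∀ p, y p ∈ F}
  have hP : P.Finite := Set.Finite.pi' (fun _ : Fin n => hF)
  obtain ⟨a, ai, ha⟩ := pieces_map A g P (fun i x hx =>
    affine_pullback F hF (MA i) (tA i) (uA i) (h1 i) (h2 i) x (by rw [← eA]; exact hx)) hA hgu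
  obtain ⟨b, bi, hb⟩ := pieces_map B h P (fun i x hx =>
    affine_pullback F hF (MB i) (tB i) (uB i) (h3 i) (h4 i) x (by rw [← eB]; exact hx)) hB hhu
  have hinj : Function.Injective (Sum.elim a b) := by
    refine ai.sumElim bi ?_
    intro x y hxy
    obtain ⟨i, hi⟩ := ha x
    obtain ⟨j, hj⟩ := hb y
    exact Set.disjoint_left.1 (hAB i j) hi (hxy ▸ hj)
  haveI : Finite P := hP
  haveI : Nonempty P := ⟨⟨0, fun _ => F.zero_mem⟩⟩
  have hc := Nat.card_le_card_of_injective _ hinj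
  rw [Nat.card_sum] at hc
  have := Nat.card_pos (α := P)
  omega
end

section
/- For any field K, the line K = K¹ is not paradoxical with respect to the group GA(1,K) of all invertible affine transformations x ↦ ax + b (a ∈ K \ {0}, b ∈ K), for any number of pieces. -/
lemma aux_val {n : ℕ} {α : Type*} [DecidableEq α] (d : α → Fin (n+1)) (q p : α)
    (h : d q ≠ Fin.last n) :
    ((d + Pi.single q 1 : α → Fin (n+1)) p).val = (d p).val + if p = q then 1 else 0 := by
  by_cases hp : p = q
  · subst hp
    simp only [Pi.add_apply, Pi.single_eq_same, if_true]
    exact Fin.val_add_one_of_lt (Fin.lt_last_iff_ne_last.mpr h)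
  · simp [Pi.single_eq_of_ne hp, hp]

lemma aux_card {Ω : Type*} [Fintype Ω] (n : ℕ) (s : Finset Ω) (T : Fin n → Ω → Ω)
    (hT : ∀ c c' ω ω', ω ∈ s → ω' ∈ s → T c ω = T c' ω' → c = c' ∧ ω = ω') :
    n * s.card ≤ Fintype.card Ω := by
  classical
  have h : ((Finset.univ : Finset (Fin n)) ×ˢ s).card ≤ (Finset.univ : Finset Ω).card := by
    apply Finset.card_le_card_of_injOn (fun p => T p.1 p.2)
    · intro x _; simp
    · rintro ⟨c, ω⟩ h1 ⟨c', ω'⟩ h2 h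
      simp at h1 h2
      obtain ⟨h3, h4⟩ := hT c c' ω ω' h1 h2 h
      rw [h3, h4]
  simpa [Finset.card_product] using h

lemma aux_key {K : Type*} [Field K] {ι : Type} [Fintype ι] [DecidableEq ι] (a b : ι → K)
    (ha : ∀ i, a i ≠ 0) (n : ℕ) :
    ∃ (Ω : Type) (_ : Fintype Ω) (_ : Nonempty Ω) (X : Ω → K) (σ : ι → Ω → Ω)
      (bad : ι → Finset Ω),
      (∀ i, Function.Surjective (σ i)) ∧
      (∀ i, (n+1) * (bad i).card ≤ 2 * Fintype.card Ω) ∧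
      ∀ i ω, ω ∉ bad i → X (σ i ω) = a i * X ω + b i := by
  classical
  let E := ι → Fin (n+1)
  let P : E → K := fun e => ∏ j, a j ^ (e j).val
  have hP : ∀ e, P e ≠ 0 := fun e => Finset.prod_ne_zero_iff.mpr fun j _ => pow_ne_zero _ (ha j)
  let v : E × ι → K := fun p => (P p.1)⁻¹ * b p.2
  let U : (E × ι → Fin (n+1)) → K := fun d => ∑ p, ((d p).val : K) * v p
  let s1 : ι → Finset (E × (E × ι → Fin (n+1))) := fun i =>
    Finset.univ.filter fun ω => ω.1 i = Fin.last n
  let s2 : ι → Finset (E × (E × ι → Fin (n+1))) := fun i =>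
    Finset.univ.filter fun ω => ω.2 (ω.1 + Pi.single i 1, i) = Fin.last n
  refine ⟨E × (E × ι → Fin (n+1)), inferInstance, inferInstance, fun ω => P ω.1 * U ω.2,
    fun i ω => (ω.1 + Pi.single i 1, ω.2 + Pi.single (ω.1 + Pi.single i 1, i) 1),
    fun i => s1 i ∪ s2 i, ?_, ?_, ?_⟩
  · rintro i ⟨e, d⟩
    exact ⟨(e - Pi.single i 1, d - Pi.single (e, i) 1), by simp⟩
  · intro i
    have h1 : (n+1) * (s1 i).card ≤ Fintype.card (E × (E × ι → Fin (n+1))) := by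
      apply aux_card (n+1) (s1 i) (fun c ω => (Function.update ω.1 i c, ω.2))
      rintro c c' ⟨e, d⟩ ⟨e', d'⟩ h h' heq
      simp only [s1, Finset.mem_filter, Finset.mem_univ, true_and] at h h'
      simp only [Prod.mk.injEq] at heq
      obtain ⟨h3, rfl⟩ := heq
      refine ⟨by simpa using congrFun h3 i, ?_⟩
      congr 1
      funext j
      by_cases hj : j = i
      · subst hj; rw [h, h']
      · simpa [hj] using congrFun h3 j
    have h2 : (n+1) * (s2 i).card ≤ Fintype.card (E × (E × ι → Fin (n+1))) := by
      apply aux_card (n+1) (s2 i)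
        (fun c ω => (ω.1, Function.update ω.2 (ω.1 + Pi.single i 1, i) c))
      rintro c c' ⟨e, d⟩ ⟨e', d'⟩ h h' heq
      simp only [s2, Finset.mem_filter, Finset.mem_univ, true_and] at h h'
      simp only [Prod.mk.injEq] at heq
      obtain ⟨rfl, h3⟩ := heq
      refine ⟨?_, ?_⟩
      · have := congrFun h3 (e + Pi.single i 1, i)
        rwa [Function.update_self, Function.update_self] at this
      congr 1
      funext j
      by_cases hj : j = (e + Pi.single i 1, i)
      · subst hj; rw [h, h']
      · have := congrFun h3 j
        rwa [Function.update_of_ne hj, Function.update_of_ne hj] at this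
    have h3 := Finset.card_union_le (s1 i) (s2 i)
    calc _ ≤ (n+1) * ((s1 i).card + (s2 i).card) := Nat.mul_le_mul_left _ h3
      _ ≤ _ := by rw [mul_add]; omega
  · rintro i ⟨e, d⟩ h
    simp only [s1, s2, Finset.mem_union, Finset.mem_filter, Finset.mem_univ, true_and,
      not_or] at h
    obtain ⟨h1, h2⟩ := h
    have e1 : P (e + Pi.single i 1) = a i * P e := by
      have hv := fun j => aux_val e i j h1
      show ∏ j, a j ^ ((e + Pi.single i 1 : ι → Fin (n+1)) j).val = a i * ∏ j, a j ^ (e j).val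
      simp only [hv, pow_add, Finset.prod_mul_distrib]
      rw [mul_comm]
      congr 1
      simp [pow_ite]
    have e2 : U (d + Pi.single (e + Pi.single i 1, i) 1) = U d + v (e + Pi.single i 1, i) := by
      have hv := fun p => aux_val d _ p h2
      simp only [U]
      simp only [hv, Nat.cast_add, add_mul, Finset.sum_add_distrib]
      congr 1
      rw [Finset.sum_eq_single (e + Pi.single i 1, i)]
      · rw [if_pos rfl, Nat.cast_one, one_mul]
      · intro p _ hp
        rw [if_neg hp, Nat.cast_zero, zero_mul]
      · intro hp
        exact absurd (Finset.mem_univ _) hp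
    show P (e + Pi.single i 1) * U (d + Pi.single (e + Pi.single i 1, i) 1) = a i * (P e * U d) + b i
    rw [e2, mul_add]
    simp only [v]
    rw [mul_inv_cancel_left₀ (hP _), e1, mul_assoc]

theorem statement18 {K : Type*} [Field K] :
    -- K = K¹ is not GA(1, K)-paradoxical, for any number of pieces
    ∀ r : ℕ, ¬ ParadoxicalUsing
      {f : K → K | ∃ a b : K, a ≠ 0 ∧ ∀ x, f x = a * x + b}
      (Set.univ : Set K) r := by
  classical
  rintro r ⟨m, k, -, -, -, A, B, g, h, hg, hh, -, -, hA, hB, hAB, -, -, hgA, -, hhB⟩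
  let f : Fin m ⊕ Fin k → K → K := Sum.elim g h
  let C : Fin m ⊕ Fin k → Set K := Sum.elim A B
  have hf : ∀ i, ∃ a b : K, a ≠ 0 ∧ ∀ x, f i x = a * x + b := by
    rintro (i | j)
    · exact hg i
    · exact hh j
  choose a b ha hab using hf
  have hC : ∀ i j, i ≠ j → Disjoint (C i) (C j) := by
    rintro (i | i) (j | j) hij
    · exact hA i j (fun h => hij (by rw [h]))
    · exact hAB i j
    · exact (hAB j i).symm
    · exact hB i j (fun h => hij (by rw [h]))
  obtain ⟨Ω, _, _, X, σ, bad, hσ, hbad, hX⟩ := aux_key a b ha (2 * (m + k))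
  let μ : Set K → ℕ := fun S => (Finset.univ.filter fun ω => X ω ∈ S).card
  have hμ : ∀ i, μ (f i '' C i) ≤ μ (C i) + (bad i).card := by
    intro i
    calc μ (f i '' C i)
        ≤ (((Finset.univ.filter fun ω => X ω ∈ C i) ∪ bad i).image (σ i)).card := by
          apply Finset.card_le_card
          intro ω hω
          simp only [Finset.mem_filter, Finset.mem_univ, true_and] at hω
          obtain ⟨ω', rfl⟩ := hσ i ω
          apply Finset.mem_image_of_mem
          by_cases hb : ω' ∈ bad i
          · exact Finset.mem_union_right _ hb
          · apply Finset.mem_union_left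
            simp only [Finset.mem_filter, Finset.mem_univ, true_and]
            rw [hX i ω' hb] at hω
            obtain ⟨x, hx, hx'⟩ := hω
            rw [hab] at hx'
            rwa [← mul_left_cancel₀ (ha i) (add_right_cancel hx')]
      _ ≤ _ := Finset.card_image_le.trans (Finset.card_union_le _ _)
  have hsum : ∑ i, μ (C i) ≤ Fintype.card Ω := by
    rw [← Finset.card_biUnion]
    · exact Finset.card_le_univ _
    · intro i _ j _ hij
      rw [Function.onFun, Finset.disjoint_left]
      intro ω h1 h2
      simp only [Finset.mem_filter, Finset.mem_univ, true_and] at h1 h2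
      exact Set.disjoint_left.mp (hC i j hij) h1 h2
  have hcov : ∀ (l : ℕ) (D : Fin l → Set K), (⋃ i, D i) = Set.univ →
      Fintype.card Ω ≤ ∑ i, μ (D i) := by
    intro l D hD
    refine le_trans ?_ Finset.card_biUnion_le
    rw [← Finset.card_univ]
    apply Finset.card_le_card
    intro ω _
    have : X ω ∈ ⋃ i, D i := hD ▸ Set.mem_univ _
    obtain ⟨i, hi⟩ := Set.mem_iUnion.mp this
    exact Finset.mem_biUnion.mpr ⟨i, Finset.mem_univ _, by simpa using hi⟩
  have c1 := hcov m _ hgA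
  have c2 := hcov k _ hhB
  have c3 : ∑ i, μ (f i '' C i) = ∑ i, μ (g i '' A i) + ∑ j, μ (h j '' B j) :=
    Fintype.sum_sum_type _
  have c4 : ∑ i, μ (f i '' C i) ≤ ∑ i, μ (C i) + ∑ i, (bad i).card := by
    rw [← Finset.sum_add_distrib]
    exact Finset.sum_le_sum fun i _ => hμ i
  have c5 : (2 * (m + k) + 1) * ∑ i, (bad i).card ≤ (m + k) * (2 * Fintype.card Ω) := by
    rw [Finset.mul_sum]
    refine (Finset.sum_le_sum fun i _ => hbad i).trans ?_
    simp
  have c6 : 0 < Fintype.card Ω := Fintype.card_pos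
  have c7 : Fintype.card Ω ≤ ∑ i, (bad i).card := by omega
  nlinarith [Nat.mul_le_mul_left (2 * (m + k) + 1) c7]
end
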